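/- arXiv:2004.09122 — 2 statements merged into one kernel-verified Lean document; each statement's English description precedes it below -/
import Mathlib

section
/- Let K ⊆ L be fields of characteristic zero and let D₁,…,D_m be pairwise commuting derivations of L, each mapping the subfield K into itself. Let η₁,…,η_n ∈ L and assume L is generated as a field over K by all iterated derivatives D₁^{α₁}∘⋯∘D_m^{α_m}(η_i) (i = 1,…,n, α ∈ ℕ^m). For k ∈ ℕ let L^{≤k} denote the subfield of L generated by K together with the derivatives D₁^{α₁}∘⋯∘D_m^{α_m}(η_i) with α₁+⋯+α_m ≤ k. Then there exist an integer ℓ with 0 ≤ ℓ ≤ m, integers a₀,…,a_ℓ, and a polynomial P(x) = Σ_{i=0}^{ℓ} a_i·C(x+i, i) (where C denotes the binomial coefficient polynomial), such that for all sufficiently large k the transcendence degree of L^{≤k} over K equals P(k). -/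
/-- The iterated derivative operator `D₁^{α₁} ∘ ⋯ ∘ D_m^{α_m}` associated to a family of
derivations `D : Fin m → L → L` and a multi-index `α : Fin m → ℕ`. -/
def iterDeriv {L : Type*} {m : ℕ} (D : Fin m → L → L) (α : Fin m → ℕ) : L → L :=
  (List.ofFn fun i => (D i)^[α i]).foldr (· ∘ ·) id

namespace Kolchin

theorem iterDeriv_succ {L : Type*} {m : ℕ} (D : Fin (m + 1) → L → L) (α : Fin (m + 1) → ℕ) :
    iterDeriv D α = (D 0)^[α 0] ∘ iterDeriv (fun i => D i.succ) (fun i => α i.succ) := by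
  simp [iterDeriv, List.ofFn_succ]

theorem comp_iterDeriv {L : Type*} {m : ℕ} (D : Fin m → L → L) (α : Fin m → ℕ)
    (E : L → L) (hE : ∀ i, Function.Commute E (D i)) :
    Function.Commute E (iterDeriv D α) := by
  induction m with
  | zero => intro x; simp [iterDeriv]
  | succ m ih =>
    rw [iterDeriv_succ]
    exact ((hE 0).iterate_right _).comp_right (ih _ _ fun i => hE _)

theorem deriv_iterDeriv {L : Type*} {m : ℕ} (D : Fin m → L → L) (α : Fin m → ℕ)
    (hcomm : ∀ i j, D i ∘ D j = D j ∘ D i) (j : Fin m) (x : L) :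
    D j (iterDeriv D α x) = iterDeriv D (α + Pi.single j 1) x := by
  have hc : ∀ i j, Function.Commute (D i) (D j) := fun i j x => congrFun (hcomm i j) x
  induction m generalizing x with
  | zero => exact j.elim0
  | succ m ih =>
    rw [iterDeriv_succ, iterDeriv_succ]
    refine Fin.cases ?_ (fun j => ?_) j
    · have : (fun i : Fin m => (α + Pi.single (0 : Fin (m+1)) 1 : Fin (m+1) → ℕ) i.succ) = fun i => α i.succ := by
        funext i; simp
      rw [this]
      simp only [Function.comp, Pi.add_apply, Pi.single_eq_same]
      rw [Function.iterate_succ_apply']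
    · have : (fun i : Fin m => (α + Pi.single j.succ 1 : Fin (m+1) → ℕ) i.succ)
          = (fun i => α i.succ) + Pi.single j 1 := by
        funext i
        simp [Pi.single_apply]
      rw [this]
      have h0 : (α + Pi.single j.succ 1 : Fin (m+1) → ℕ) 0 = α 0 := by simp
      rw [h0]
      simp only [Function.comp]
      rw [← ih (fun i => D i.succ) (fun i => α i.succ) (fun i j => hcomm _ _) j x
        (fun i j => hc _ _)]
      exact (hc j.succ 0).iterate_right (α 0) _

theorem der_mem_adjoin {K L : Type*} [Field K] [Field L] [Algebra K L]
    (D : Derivation ℤ L L)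
    (hK : ∀ x ∈ Set.range (algebraMap K L), D x ∈ Set.range (algebraMap K L))
    (S S' : Set L) (hS : S ⊆ S') (hDS : ∀ s ∈ S, D s ∈ S') (z : L)
    (hz : z ∈ IntermediateField.adjoin K S) : D z ∈ IntermediateField.adjoin K S' := by
  have hle : IntermediateField.adjoin K S ≤ IntermediateField.adjoin K S' :=
    IntermediateField.adjoin.mono _ _ _ hS
  induction hz using IntermediateField.adjoin_induction with
  | mem x hx => exact IntermediateField.subset_adjoin _ _ (hDS x hx)
  | algebraMap x =>
    obtain ⟨y, hy⟩ := hK _ ⟨x, rfl⟩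
    rw [← hy]; exact IntermediateField.algebraMap_mem _ _
  | add x y hx hy h1 h2 => rw [map_add]; exact add_mem h1 h2
  | inv x hx h =>
    rw [Derivation.leibniz_inv, smul_eq_mul]
    exact mul_mem (neg_mem (pow_mem (inv_mem (hle hx)) _)) h
  | mul x y hx hy h1 h2 =>
    rw [Derivation.leibniz]
    exact add_mem (mul_mem (hle hx) h2) (mul_mem (hle hy) h1)

theorem der_algebraic {K L : Type*} [Field K] [Field L] [CharZero L] [Algebra K L]
    (D : Derivation ℤ L L)
    (hK : ∀ x ∈ Set.range (algebraMap K L), D x ∈ Set.range (algebraMap K L))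
    (S S' : Set L) (hS : S ⊆ S') (hDS : ∀ s ∈ S, D s ∈ S') (u : L) (huS : u ∈ S')
    (hu : IsAlgebraic (IntermediateField.adjoin K S) u) :
    D u ∈ IntermediateField.adjoin K S' := by
  have hle : IntermediateField.adjoin K S ≤ IntermediateField.adjoin K S' :=
    IntermediateField.adjoin.mono _ _ _ hS
  have hu' : u ∈ IntermediateField.adjoin K S' := IntermediateField.subset_adjoin _ _ huS
  have hi := hu.isIntegral
  set p := minpoly (IntermediateField.adjoin K S) u with hp
  have hsep : p.Separable := (minpoly.irreducible hi).separable
  have h0 : Polynomial.aeval u p = 0 := minpoly.aeval _ _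
  have h1 := hsep.aeval_derivative_ne_zero h0
  have h2 : ∀ q : Polynomial (IntermediateField.adjoin K S),
      D (Polynomial.aeval u q) - Polynomial.aeval u (Polynomial.derivative q) * D u
        ∈ IntermediateField.adjoin K S' := by
    intro q
    induction q using Polynomial.induction_on' with
    | add f g hf hg =>
      have := add_mem hf hg
      convert this using 1
      simp only [map_add]; ring
    | monomial k c =>
      rw [Polynomial.derivative_monomial, Polynomial.aeval_monomial, Polynomial.aeval_monomial,
        Derivation.leibniz, Derivation.leibniz_pow]
      have h3 := mul_mem (pow_mem hu' k) (der_mem_adjoin D hK S S' hS hDS _ c.2)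
      convert h3 using 1
      simp only [smul_eq_mul, nsmul_eq_mul, map_mul, map_natCast,
        IntermediateField.algebraMap_apply]
      ring
  have h3 := h2 p
  rw [h0, map_zero, zero_sub] at h3
  have h4 : D u = -((Polynomial.aeval u (Polynomial.derivative p))⁻¹ *
      -(Polynomial.aeval u (Polynomial.derivative p) * D u)) := by
    field_simp
  rw [h4]
  refine neg_mem (mul_mem (inv_mem ?_) h3)
  rw [Polynomial.aeval_def, Polynomial.eval₂_eq_sum, Polynomial.sum_def]
  exact sum_mem fun i _ => mul_mem (hle (SetLike.coe_mem _)) (pow_mem hu' _)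

/-- `a` is dependent on the earlier elements -/
def Dep (K : Type*) {L ι Γ : Type*} [Field K] [Field L] [Algebra K L] [LinearOrder Γ]
    (key : ι → Γ) (x : ι → L) (a : ι) : Prop :=
  IsAlgebraic (Algebra.adjoin K (x '' {b | key b < key a})) (x a)

theorem indep {K L ι Γ : Type*} [Field K] [Field L] [Algebra K L] [LinearOrder Γ]
    (key : ι → Γ) (hkey : Function.Injective key) (x : ι → L) (T : Finset ι)
    (hT : ∀ a ∈ T, ¬ Dep K key x a) : AlgebraicIndepOn K x (T : Set ι) := by
  classical
  induction T using Finset.induction_on_max_value key with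
  | empty =>
    rw [Finset.coe_empty]
    have : IsEmpty ((∅ : Set ι)) := inferInstance
    exact (algebraicIndependent_empty_type_iff).2 (algebraMap K L).injective
  | insert a s has hmax ih =>
    rw [Finset.coe_insert]
    refine AlgebraicIndepOn.insert (ih fun b hb => hT b (Finset.mem_insert_of_mem hb)) ?_
    refine Transcendental.of_tower_top_of_subalgebra_le (Algebra.adjoin_mono ?_)
      (hT a (Finset.mem_insert_self _ _))
    apply Set.image_mono
    intro b hb
    exact lt_of_le_of_ne (hmax b hb) fun h => has (hkey h ▸ hb)

theorem span {K L ι Γ : Type*} [Field K] [Field L] [Algebra K L] [LinearOrder Γ]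
    [WellFoundedLT Γ] (key : ι → Γ) (x : ι → L) (U : Set ι)
    (hU : ∀ a b, key a < key b → b ∈ U → a ∈ U) (a : ι) (ha : a ∈ U) :
    IsAlgebraic (Algebra.adjoin K (x '' {b ∈ U | ¬ Dep K key x b})) (x a) := by
  induction hk : key a using WellFoundedLT.induction generalizing a with
  | ind g ih =>
    subst hk
    by_cases hd : Dep K key x a
    · refine IsAlgebraic.adjoin_of_forall_isAlgebraic ?_ hd
      rintro _ ⟨⟨b, hb, rfl⟩, -⟩
      exact ih _ hb b (hU _ _ hb ha) rfl
    · exact isAlgebraic_algebraMap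
        (⟨x a, Algebra.subset_adjoin ⟨a, ⟨ha, hd⟩, rfl⟩⟩ :
          Algebra.adjoin K (x '' {b ∈ U | ¬ Dep K key x b}))

theorem exists_basis {K L ι Γ : Type*} [Field K] [Field L] [Algebra K L] [LinearOrder Γ]
    [WellFoundedLT Γ] (key : ι → Γ) (hkey : Function.Injective key) (x : ι → L) (U : Set ι)
    (hU : ∀ a b, key a < key b → b ∈ U → a ∈ U) (S : Set L) (hS : S = x '' U) (T : Finset ι)
    (hT : ∀ a, a ∈ T ↔ a ∈ U ∧ ¬ Dep K key x a) :
    ∃ s : Finset (IntermediateField.adjoin K S),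
      IsTranscendenceBasis K (fun y : s => (y : IntermediateField.adjoin K S)) ∧
      s.card = T.card := by
  classical
  have hmem : ∀ a ∈ T, x a ∈ IntermediateField.adjoin K S := fun a ha =>
    IntermediateField.subset_adjoin _ _ (hS ▸ ⟨a, ((hT a).1 ha).1, rfl⟩)
  let y : T → IntermediateField.adjoin K S := fun a => ⟨x a, hmem a a.2⟩
  have hind : AlgebraicIndependent K y := by
    refine AlgebraicIndependent.of_comp (IntermediateField.adjoin K S).val ?_
    exact indep key hkey x T fun a ha => ((hT a).1 ha).2
  have hbasis : IsTranscendenceBasis K y := by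
    rw [isTranscendenceBasis_iff_algebraicIndependent_isAlgebraic]
    refine ⟨hind, ⟨fun z => ?_⟩⟩
    have h1 : IsAlgebraic (Algebra.adjoin K (x '' T)) (z : L) := by
      have h2 : IsAlgebraic (Algebra.adjoin K S) (z : L) :=
        IntermediateField.isAlgebraic_adjoin_iff.1 (isAlgebraic_algebraMap z)
      refine IsAlgebraic.adjoin_of_forall_isAlgebraic ?_ h2
      rintro u ⟨hu, -⟩
      rw [hS] at hu
      obtain ⟨a, ha, rfl⟩ := hu
      have := span (K := K) key x U hU a ha
      have heq : (T : Set ι) = {b ∈ U | ¬ Dep K key x b} := by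
        ext b; simp [hT]
      rw [heq]; exact this
    have himg : (Algebra.adjoin K (Set.range y)).map (IntermediateField.adjoin K S).val
        = Algebra.adjoin K (x '' T) := by
      rw [AlgHom.map_adjoin, ← Set.range_comp]
      congr 1
      ext u; simp [y]
    rw [← himg] at h1
    let e := (Algebra.adjoin K (Set.range y)).equivMapOfInjective
      (IntermediateField.adjoin K S).val (IntermediateField.adjoin K S).val.injective
    exact IsAlgebraic.of_ringHom_of_comp_eq (e : _ →+* _)
      ((IntermediateField.adjoin K S).val : _ →+* L) h1 e.surjective
      (IntermediateField.adjoin K S).val.injective rfl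
  refine ⟨Finset.univ.image y, ?_, ?_⟩
  · have := hbasis.to_subtype_range' (t := ((Finset.univ.image y : Finset _) : Set _)) (by simp)
    exact this
  · rw [Finset.card_image_of_injective _ hind.injective]; simp

end Kolchin

namespace Kolchin

/-- functions eventually equal to an integer combination of `C(k+i,i)`, `i ≤ m` -/
def Good (m : ℕ) : AddSubgroup (ℕ → ℤ) where
  carrier := {f | ∃ (a : Fin (m + 1) → ℤ) (k₀ : ℕ), ∀ k : ℕ, k₀ ≤ k →
    f k = ∑ i : Fin (m + 1), a i * ((k + (i : ℕ)).choose (i : ℕ) : ℤ)}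
  zero_mem' := ⟨0, 0, fun k _ => by simp⟩
  add_mem' := by
    rintro f g ⟨a, k, h⟩ ⟨b, l, h'⟩
    refine ⟨a + b, max k l, fun t ht => ?_⟩
    simp only [Pi.add_apply, add_mul, Finset.sum_add_distrib]
    rw [h t (le_trans (le_max_left _ _) ht), h' t (le_trans (le_max_right _ _) ht)]
  neg_mem' := by
    rintro f ⟨a, k, h⟩
    refine ⟨-a, k, fun t ht => ?_⟩
    simp only [Pi.neg_apply, neg_mul, Finset.sum_neg_distrib]
    rw [h t ht]

theorem Good.congr {m : ℕ} {f g : ℕ → ℤ} (hf : f ∈ Good m) (k₁ : ℕ)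
    (h : ∀ k, k₁ ≤ k → g k = f k) : g ∈ Good m := by
  obtain ⟨a, k, hk⟩ := hf
  exact ⟨a, max k k₁, fun t ht => by
    rw [h t (le_trans (le_max_right _ _) ht), hk t (le_trans (le_max_left _ _) ht)]⟩

theorem Good.shift (M b : ℕ) : ∀ m ≤ M, (fun k => (((k - b) + m).choose m : ℤ)) ∈ Good M := by
  induction b with
  | zero =>
    intro m hm
    refine ⟨Pi.single ⟨m, by omega⟩ 1, 0, fun k _ => ?_⟩
    rw [Finset.sum_eq_single (⟨m, by omega⟩ : Fin (M + 1))]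
    · simp
    · intro i _ hi; simp [hi]
    · simp
  | succ b ih =>
    intro m hm
    rcases m with _ | m
    · simpa using ih 0 (by omega)
    · refine Good.congr (sub_mem (ih (m + 1) hm) (ih m (by omega))) (b + 1) fun k hk => ?_
      obtain ⟨t, rfl⟩ := Nat.exists_eq_add_of_le hk
      simp only [Pi.sub_apply]
      have e1 : b + 1 + t - (b + 1) = t := by omega
      have e2 : b + 1 + t - b = t + 1 := by omega
      rw [e1, e2]
      have : (t + 1 + (m + 1)).choose (m + 1) = (t + 1 + m).choose m + (t + (m + 1)).choose (m + 1) := by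
        rw [show t + 1 + (m + 1) = (t + 1 + m) + 1 by ring, Nat.choose_succ_succ,
          show t + 1 + m = t + (m + 1) by ring]
      rw [this]; push_cast; ring

/-- multi-indices of total degree at most `k` -/
def simplex (m k : ℕ) : Finset (Fin m → ℕ) :=
  (Fintype.piFinset fun _ => Finset.range (k + 1)).filter fun α => ∑ j, α j ≤ k

theorem mem_simplex {m k : ℕ} {α : Fin m → ℕ} : α ∈ simplex m k ↔ ∑ j, α j ≤ k := by
  simp only [simplex, Finset.mem_filter, Fintype.mem_piFinset, Finset.mem_range,
    and_iff_right_iff_imp]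
  intro h j
  have := Finset.single_le_sum (f := α) (fun i _ => Nat.zero_le _) (Finset.mem_univ j)
  omega

theorem card_simplex (m k : ℕ) : (simplex m k).card = (k + m).choose m := by
  classical
  induction m generalizing k with
  | zero =>
    have : simplex 0 k = Finset.univ := by ext α; simp only [mem_simplex, Finset.mem_univ, iff_true]; simp
    rw [this]; simp
  | succ m ih =>
    have key : ∀ k, ((simplex (m + 1) k).filter fun α => α 0 = 0).card = (simplex m k).card := by
      intro k
      symm
      refine Finset.card_bij (fun β _ => Fin.cons 0 β) ?_ ?_ ?_
      · intro β hβ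
        simpa [mem_simplex, Fin.sum_univ_succ] using mem_simplex.1 hβ
      · intro a _ b _ h
        exact (Fin.cons_injective2 h).2
      · intro α hα
        simp only [Finset.mem_filter, mem_simplex] at hα
        refine ⟨Fin.tail α, ?_, ?_⟩
        · rw [mem_simplex]
          have := hα.1
          rw [Fin.sum_univ_succ] at this
          simp only [Fin.tail]; omega
        · rw [← hα.2]; exact Fin.cons_self_tail α
    induction k with
    | zero =>
      have : simplex (m + 1) 0 = {0} := by
        ext α; simp [mem_simplex, funext_iff]
      rw [this]; simp
    | succ k ihk =>
      rw [← Finset.card_filter_add_card_filter_not (fun α : Fin (m + 1) → ℕ => α 0 = 0), key, ih]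
      have : ((simplex (m + 1) (k + 1)).filter fun α => ¬ α 0 = 0).card
          = (simplex (m + 1) k).card := by
        symm
        refine Finset.card_bij (fun β _ => β + Pi.single 0 1) ?_ ?_ ?_
        · intro β hβ
          rw [mem_simplex] at hβ
          simp [mem_simplex, Finset.sum_add_distrib, hβ]
        · intro a _ b _ h
          exact add_right_cancel h
        · intro α hα
          simp only [Finset.mem_filter, mem_simplex] at hα
          have hle : Pi.single 0 1 ≤ α := by
            intro i
            by_cases hi : i = 0
            · subst hi; simp; omega
            · simp [hi]
          have he : α - Pi.single 0 1 + Pi.single 0 1 = α := tsub_add_cancel_of_le hle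
          refine ⟨α - Pi.single 0 1, ?_, he⟩
          rw [mem_simplex]
          have h1 := hα.1
          rw [← he] at h1
          simp only [Pi.add_apply, Finset.sum_add_distrib, Finset.sum_pi_single',
            Finset.mem_univ, if_true] at h1
          omega
      rw [this, ihk, show k + 1 + (m + 1) = (k + 1 + m) + 1 by ring, Nat.choose_succ_succ,
          show k + 1 + m = k + (m + 1) by ring]

open Classical in
/-- number of multi-indices of degree `≤ k` with a property -/
noncomputable def cnt {m : ℕ} (P : (Fin m → ℕ) → Prop) (k : ℕ) : ℤ :=
  ((simplex m k).filter P).card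

theorem cnt_eq {m : ℕ} (P : (Fin m → ℕ) → Prop) [DecidablePred P] (k : ℕ) :
    cnt P k = ((simplex m k).filter P).card := by
  unfold cnt
  congr

theorem cnt_principal {m : ℕ} (β : Fin m → ℕ) : cnt (fun α => β ≤ α) ∈ Good m := by
  classical
  refine Good.congr (Good.shift m (∑ j, β j) m le_rfl) (∑ j, β j) fun k hk => ?_
  rw [cnt, ← card_simplex, Nat.cast_inj]
  symm
  refine Finset.card_bij (fun α _ => α + β) ?_ ?_ ?_
  · intro α hα
    rw [mem_simplex] at hα
    simp only [Finset.mem_filter, mem_simplex, Pi.add_apply, Finset.sum_add_distrib]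
    exact ⟨by omega, le_add_self⟩
  · intro a _ b _ h
    exact add_right_cancel h
  · intro α hα
    simp only [Finset.mem_filter, mem_simplex] at hα
    have he : α - β + β = α := tsub_add_cancel_of_le hα.2
    refine ⟨α - β, ?_, he⟩
    have h1 := hα.1
    rw [← he] at h1
    simp only [Pi.add_apply, Finset.sum_add_distrib] at h1
    rw [mem_simplex]; omega

theorem cnt_up {m : ℕ} (N : ℕ) : ∀ A : Finset (Fin m → ℕ), A.card ≤ N →
    cnt (fun α => ∃ β ∈ A, β ≤ α) ∈ Good m := by
  classical
  induction N with
  | zero =>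
    intro A hA
    have : A = ∅ := by simpa using hA
    subst this
    refine Good.congr (zero_mem _) 0 fun k _ => by simp [cnt]
  | succ N ih =>
    intro A hA
    by_cases hA' : A = ∅
    · exact ih A (by simp [hA'])
    obtain ⟨β, hβ⟩ := Finset.nonempty_iff_ne_empty.2 hA'
    have hc : (A.erase β).card ≤ N := by
      rw [Finset.card_erase_of_mem hβ]; omega
    have h1 := ih _ hc
    have h2 := ih ((A.erase β).image (β ⊔ ·)) (Finset.card_image_le.trans hc)
    have h3 := cnt_principal β
    refine Good.congr (sub_mem (add_mem h1 h3) h2) 0 fun k _ => ?_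
    simp only [Pi.sub_apply, Pi.add_apply, cnt_eq]
    have hun : (simplex m k).filter (fun α => ∃ β ∈ A, β ≤ α)
      = (simplex m k).filter (fun α => ∃ γ ∈ A.erase β, γ ≤ α)
        ∪ (simplex m k).filter (fun α => β ≤ α) := by
      rw [← Finset.filter_or]
      apply Finset.filter_congr
      intro α _
      constructor
      · rintro ⟨γ, hγ, h⟩
        by_cases hg : γ = β
        · right; exact hg ▸ h
        · left; exact ⟨γ, Finset.mem_erase.2 ⟨hg, hγ⟩, h⟩
      · rintro (⟨γ, hγ, h⟩ | h)
        · exact ⟨γ, Finset.mem_of_mem_erase hγ, h⟩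
        · exact ⟨β, hβ, h⟩
    have hin : (simplex m k).filter (fun α => ∃ γ ∈ (A.erase β).image (β ⊔ ·), γ ≤ α)
      = (simplex m k).filter (fun α => ∃ γ ∈ A.erase β, γ ≤ α)
        ∩ (simplex m k).filter (fun α => β ≤ α) := by
      rw [← Finset.filter_and]
      apply Finset.filter_congr
      intro α _
      constructor
      · rintro ⟨γ, hγ, h⟩
        obtain ⟨δ, hδ, rfl⟩ := Finset.mem_image.1 hγ
        exact ⟨⟨δ, hδ, le_sup_right.trans h⟩, le_sup_left.trans h⟩
      · rintro ⟨⟨γ, hγ, h⟩, h'⟩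
        exact ⟨β ⊔ γ, Finset.mem_image_of_mem _ hγ, sup_le h' h⟩
    rw [hun, hin]
    have := Finset.card_union_add_card_inter
      ((simplex m k).filter (fun α => ∃ γ ∈ A.erase β, γ ≤ α))
      ((simplex m k).filter (fun α => β ≤ α))
    omega

theorem cnt_upset {m : ℕ} (P : (Fin m → ℕ) → Prop) (hP : ∀ α β, α ≤ β → P α → P β) :
    cnt P ∈ Good m := by
  have hfin : {α | Minimal P α}.Finite :=
    WellQuasiOrderedLE.finite_of_isAntichain (setOfPred_minimal_antichain P)
  have h := cnt_up _ hfin.toFinset le_rfl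
  convert h using 2
  ext α
  simp only [Set.Finite.mem_toFinset, Set.mem_ofPred_eq]
  constructor
  · intro h
    obtain ⟨b, hb, hm⟩ := (Set.isPWO_of_wellQuasiOrderedLE {α | P α}).exists_le_minimal h
    exact ⟨b, hm, hb⟩
  · rintro ⟨β, hβ, h⟩
    exact hP _ _ h hβ.1

theorem cnt_downset {m : ℕ} (P : (Fin m → ℕ) → Prop) (hP : ∀ α β, α ≤ β → P α → P β) :
    cnt (fun α => ¬ P α) ∈ Good m := by
  classical
  have h0 : (fun k => ((simplex m k).card : ℤ)) ∈ Good m := by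
    refine Good.congr (Good.shift m 0 m le_rfl) 0 fun k _ => ?_
    rw [card_simplex]; simp
  refine Good.congr (sub_mem h0 (cnt_upset P hP)) 0 fun k _ => ?_
  simp only [Pi.sub_apply, cnt_eq]
  have := Finset.card_filter_add_card_filter_not (s := simplex m k) P
  omega

/-- the orderly ranking -/
def key {m n : ℕ} (a : Fin n × (Fin m → ℕ)) : ℕ ×ₗ (Lex (Fin m → ℕ) ×ₗ Fin n) :=
  toLex (∑ j, a.2 j, toLex (toLex a.2, a.1))

theorem key_injective {m n : ℕ} : Function.Injective (key (m := m) (n := n)) := by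
  rintro ⟨i, α⟩ ⟨j, β⟩ h
  have h2 := congrArg (fun z => (ofLex (ofLex z).2)) h
  simp only [key, ofLex_toLex, Prod.mk.injEq] at h2
  have h3 : α = β := h2.1
  rw [h3, h2.2]

theorem key_lt {m n : ℕ} (a b : Fin n × (Fin m → ℕ)) : key a < key b ↔
    (∑ j, a.2 j < ∑ j, b.2 j) ∨ (∑ j, a.2 j = ∑ j, b.2 j) ∧
      (toLex a.2 < toLex b.2 ∨ toLex a.2 = toLex b.2 ∧ a.1 < b.1) := by
  simp [key, Prod.Lex.toLex_lt_toLex]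

theorem key_shift {m n : ℕ} (a b : Fin n × (Fin m → ℕ)) (γ : Fin m → ℕ) (h : key a < key b) :
    key (a.1, a.2 + γ) < key (b.1, b.2 + γ) := by
  rw [key_lt] at h ⊢
  simp only [Pi.add_apply, Finset.sum_add_distrib, toLex_add, add_lt_add_iff_right,
    add_left_inj]
  exact h

theorem key_self {m n : ℕ} (a : Fin n × (Fin m → ℕ)) (j : Fin m) :
    key a < key (a.1, a.2 + Pi.single j 1) := by
  rw [key_lt]
  left
  simp [Finset.sum_add_distrib]

theorem dep_shift {K L : Type*} [Field K] [Field L] [CharZero L] [Algebra K L]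
    {m n : ℕ} (D : Fin m → L → L) (η : Fin n → L)
    (hadd : ∀ i, ∀ x y : L, D i (x + y) = D i x + D i y)
    (hleibniz : ∀ i, ∀ x y : L, D i (x * y) = x * D i y + D i x * y)
    (hcomm : ∀ i j, D i ∘ D j = D j ∘ D i)
    (hK : ∀ i, ∀ x ∈ Set.range (algebraMap K L), D i x ∈ Set.range (algebraMap K L))
    (i : Fin n) (α : Fin m → ℕ) (j : Fin m)
    (h : Dep K key (fun a : Fin n × (Fin m → ℕ) => iterDeriv D a.2 (η a.1)) (i, α)) :
    Dep K key (fun a : Fin n × (Fin m → ℕ) => iterDeriv D a.2 (η a.1))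
      (i, α + Pi.single j 1) := by
  let δ : Derivation ℤ L L := Derivation.mk'
    ((AddMonoidHom.mk' (D j) (hadd j)).toIntLinearMap) (by
      intro a b
      change D j (a * b) = a * D j b + b * D j a
      rw [hleibniz]; ring)
  have hδ : ∀ x, δ x = D j x := fun x => rfl
  unfold Dep at h ⊢
  rw [← IntermediateField.isAlgebraic_adjoin_iff] at h ⊢
  dsimp only
  rw [← deriv_iterDeriv D α hcomm, ← hδ]
  have := der_algebraic δ (hK j) _
    ((fun a : Fin n × (Fin m → ℕ) => iterDeriv D a.2 (η a.1)) ''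
      {b | key b < key (i, α + Pi.single j 1)}) ?_ ?_ _ ?_ h
  · exact isAlgebraic_algebraMap (⟨_, this⟩ : IntermediateField.adjoin K _)
  · apply Set.image_mono
    intro b hb
    exact lt_trans hb (key_self (i, α) j)
  · rintro _ ⟨b, hb, rfl⟩
    refine ⟨(b.1, b.2 + Pi.single j 1), key_shift _ _ _ hb, ?_⟩
    rw [hδ, deriv_iterDeriv D b.2 hcomm]
  · exact ⟨(i, α), key_self (i, α) j, rfl⟩

theorem up_of_shift {m : ℕ} (P : (Fin m → ℕ) → Prop)
    (hP : ∀ α j, P α → P (α + Pi.single j 1)) : ∀ α β, α ≤ β → P α → P β := by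
  have key : ∀ (N : ℕ) (α γ : Fin m → ℕ), ∑ j, γ j = N → P α → P (α + γ) := by
    intro N
    induction N with
    | zero =>
      intro α γ h hα
      have : γ = 0 := by
        funext j; simpa using (Finset.sum_eq_zero_iff.1 h) j (Finset.mem_univ _)
      simpa [this] using hα
    | succ N ih =>
      intro α γ h hα
      have : ∃ j, γ j ≠ 0 := by
        by_contra hc
        push Not at hc
        simp [hc] at h
      obtain ⟨j, hj⟩ := this
      have hle : Pi.single j 1 ≤ γ := by
        intro i
        by_cases hi : i = j
        · subst hi; simp; omega
        · simp [hi]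
      have he : γ - Pi.single j 1 + Pi.single j 1 = γ := tsub_add_cancel_of_le hle
      rw [← he, ← add_assoc]
      apply hP
      apply ih _ _ _ hα
      rw [← he] at h
      simp only [Pi.add_apply, Finset.sum_add_distrib, Finset.sum_pi_single',
            Finset.mem_univ, if_true] at h
      omega
  intro α β h hα
  have := key _ α (β - α) rfl hα
  rwa [add_tsub_cancel_of_le h] at this

end Kolchin

/-- **Kolchin's differential dimension polynomial.** Let `K ⊆ L` be fields of
characteristic zero, `D₁, …, D_m` pairwise commuting derivations of `L` mapping `K` into
itself, and `η₁, …, η_n ∈ L` such that `L` is generated over `K` by all iterated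
derivatives of the `η_i`.  Let `L^{≤k}` be the subfield generated over `K` by the
derivatives of order `≤ k`.  Then there are `ℓ ≤ m` and integers `a₀, …, a_ℓ` such that
for all sufficiently large `k`, the transcendence degree of `L^{≤k}` over `K` equals
`P(k) = ∑_{i=0}^{ℓ} a_i · C(k+i, i)`. -/
theorem stmt_0 (K L : Type*) [Field K] [Field L] [CharZero L] [Algebra K L]
    (m n : ℕ) (D : Fin m → L → L) (η : Fin n → L)
    (hadd : ∀ i, ∀ x y : L, D i (x + y) = D i x + D i y)
    (hleibniz : ∀ i, ∀ x y : L, D i (x * y) = x * D i y + D i x * y)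
    (hcomm : ∀ i j, D i ∘ D j = D j ∘ D i)
    (hK : ∀ i, ∀ x ∈ Set.range (algebraMap K L), D i x ∈ Set.range (algebraMap K L))
    (hgen : IntermediateField.adjoin K
        {x : L | ∃ (i : Fin n) (α : Fin m → ℕ), x = iterDeriv D α (η i)} = ⊤) :
    ∃ ℓ : ℕ, ℓ ≤ m ∧ ∃ (a : Fin (ℓ + 1) → ℤ) (k₀ : ℕ), ∀ k : ℕ, k₀ ≤ k →
      ∃ s : Finset (IntermediateField.adjoin K
          {x : L | ∃ (i : Fin n) (α : Fin m → ℕ),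
            (∑ j, α j) ≤ k ∧ x = iterDeriv D α (η i)}),
        IsTranscendenceBasis K (fun y : s => (y : (IntermediateField.adjoin K
          {x : L | ∃ (i : Fin n) (α : Fin m → ℕ),
            (∑ j, α j) ≤ k ∧ x = iterDeriv D α (η i)}))) ∧
        (s.card : ℤ) = ∑ i : Fin (ℓ + 1), a i * ((k + (i : ℕ)).choose (i : ℕ) : ℤ) := by
  classical
  let x : Fin n × (Fin m → ℕ) → L := fun a => iterDeriv D a.2 (η a.1)
  let dep : Fin n → (Fin m → ℕ) → Prop := fun i α => Kolchin.Dep K Kolchin.key x (i, α)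
  have hgood : (∑ i : Fin n, Kolchin.cnt (fun α => ¬ dep i α)) ∈ Kolchin.Good m := by
    refine sum_mem fun i _ => Kolchin.cnt_downset _ ?_
    exact Kolchin.up_of_shift _ fun α j h =>
      Kolchin.dep_shift D η hadd hleibniz hcomm hK i α j h
  obtain ⟨a, k₀, hk⟩ := hgood
  refine ⟨m, le_rfl, a, k₀, fun k hkk => ?_⟩
  let T : Finset (Fin n × (Fin m → ℕ)) :=
    (Finset.univ ×ˢ Kolchin.simplex m k).filter fun b => ¬ dep b.1 b.2
  obtain ⟨s, hs, hc⟩ := Kolchin.exists_basis (K := K) Kolchin.key Kolchin.key_injective x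
    {b | ∑ j, b.2 j ≤ k} (by
      intro a b hab hb
      rw [Kolchin.key_lt] at hab
      simp only [Set.mem_ofPred_eq] at hb ⊢
      omega)
    {x : L | ∃ (i : Fin n) (α : Fin m → ℕ), (∑ j, α j) ≤ k ∧ x = iterDeriv D α (η i)} (by
      ext u
      constructor
      · rintro ⟨i, α, h, rfl⟩; exact ⟨(i, α), h, rfl⟩
      · rintro ⟨⟨i, α⟩, h, rfl⟩; exact ⟨i, α, h, rfl⟩) T (by
      intro b
      simp [T, Kolchin.mem_simplex, dep])
  refine ⟨s, hs, ?_⟩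
  rw [← hk k hkk, hc, Finset.sum_apply]
  simp only [Kolchin.cnt_eq, T]
  rw [Finset.card_filter, Finset.sum_product]
  push_cast
  refine Finset.sum_congr rfl fun i _ => ?_
  rw [Finset.card_filter]
  push_cast
  rfl
end

section
/- Let f : P → N be a morphism of schemes of finite type over ℂ which is dominant (has dense image), where N is irreducible, and let O ⊆ P be a dense open subset (of the underlying topological space of P). Then there exists a nonempty open subset W of N such that for every closed point y ∈ W, the set f⁻¹(y) ∩ O is dense in the fiber f⁻¹(y), equipped with the subspace topology. -/
universe u

open TensorProduct in
theorem gf_flat_ext {A M N P : Type u} [CommRing A] [AddCommGroup M] [AddCommGroup N]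
    [AddCommGroup P] [Module A M] [Module A N] [Module A P] (f : M →ₗ[A] N) (g : N →ₗ[A] P)
    (hf : Function.Injective f) (hg : Function.Surjective g) (h : Function.Exact f g)
    [Module.Flat A M] [Module.Flat A P] : Module.Flat A N := by
  rw [Module.Flat.iff_lTensor_preserves_injective_linearMap]
  intro X Y _ _ _ _ v hv
  rw [injective_iff_map_eq_zero]
  intro z hz
  have hP := Module.Flat.lTensor_preserves_injective_linearMap (M := P) v hv
  have hM := Module.Flat.lTensor_preserves_injective_linearMap (M := M) v hv
  have h1 : g.rTensor X z = 0 := by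
    apply hP
    rw [map_zero, ← LinearMap.comp_apply, LinearMap.lTensor_comp_rTensor,
      ← LinearMap.rTensor_comp_lTensor, LinearMap.comp_apply, hz, map_zero]
  obtain ⟨m, rfl⟩ := (rTensor_exact X h hg z).1 h1
  have h2 : Function.Injective (f.rTensor Y) :=
    (LinearMap.lTensor_inj_iff_rTensor_inj Y f).1
      (LinearMap.lTensor_injective_of_exact_of_flat g hg f hf h Y)
  have : m = 0 := by
    apply hM
    apply h2
    rw [map_zero, map_zero, ← hz, ← LinearMap.comp_apply, LinearMap.rTensor_comp_lTensor,
      ← LinearMap.lTensor_comp_rTensor, LinearMap.comp_apply]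
  rw [this, map_zero]

theorem gf_flat_union {A X : Type u} [CommRing A] [AddCommGroup X] [Module A X]
    (H : ∀ (l : ℕ) (x : Fin l → X), ∃ (Y : Type u) (_ : AddCommGroup Y) (_ : Module A Y)
      (i : Y →ₗ[A] X), Module.Flat A Y ∧ Function.Injective i ∧ ∀ j, x j ∈ Set.range i) :
    Module.Flat A X := by
  apply Module.Flat.of_forall_isTrivialRelation
  intro l f x hx
  obtain ⟨Y, _, _, i, hY, hi, hr⟩ := H l x
  choose y hy using hr
  have h0 : ∑ j, f j • y j = 0 := by
    apply hi
    simp [map_sum, hy, hx]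
  obtain ⟨k, a, z, h1, h2⟩ := Module.Flat.isTrivialRelation_of_sum_smul_eq_zero h0
  refine ⟨k, a, fun j => i (z j), fun j => ?_, h2⟩
  rw [← hy, h1]
  simp

/-- `M` is flat at all primes in `D(a)`. -/
def GF {A : Type u} [CommRing A] (a : A) (M : Type u) [AddCommGroup M] [Module A M] : Prop :=
  ∀ (p : Ideal A) [p.IsPrime], a ∉ p → Module.Flat A (LocalizedModule p.primeCompl M)

section
variable {A M N P : Type u} [CommRing A] [AddCommGroup M] [AddCommGroup N]
    [AddCommGroup P] [Module A M] [Module A N] [Module A P]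

theorem GF.mono {a b : A} (hab : a ∣ b) (h : GF a M) : GF b M := by
  intro p _ hb
  exact h p fun ha => hb (Ideal.mem_of_dvd _ hab ha)

theorem GF.ext {a : A} (f : M →ₗ[A] N) (g : N →ₗ[A] P)
    (hf : Function.Injective f) (hg : Function.Surjective g) (h : Function.Exact f g)
    (hM : GF a M) (hP : GF a P) : GF a N := by
  intro p _ ha
  have := hM p ha
  have := hP p ha
  exact gf_flat_ext _ _
    (IsLocalizedModule.map_injective p.primeCompl (LocalizedModule.mkLinearMap _ M)
      (LocalizedModule.mkLinearMap _ N) f hf)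
    (IsLocalizedModule.map_surjective p.primeCompl (LocalizedModule.mkLinearMap _ N)
      (LocalizedModule.mkLinearMap _ P) g hg) (LocalizedModule.map_exact p.primeCompl f g h)

theorem GF.equiv {a : A} (e : M ≃ₗ[A] N) (hM : GF a M) : GF a N := by
  intro p _ ha
  have := hM p ha
  exact Module.Flat.of_linearEquiv
    ((IsLocalizedModule.mapEquiv p.primeCompl (LocalizedModule.mkLinearMap p.primeCompl M)
      (LocalizedModule.mkLinearMap p.primeCompl N) (Localization.AtPrime p) e).restrictScalars A).symm

theorem GF.union {a : A} (Y : ℕ → Submodule A M) (hmono : Monotone Y) (htop : ∀ m, ∃ i, m ∈ Y i)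
    (hY : ∀ i, GF a (Y i)) : GF a M := by
  intro p _ ha
  apply gf_flat_union
  intro l x
  have hx : ∀ j, ∃ i, ∃ m ∈ Y i, ∃ s : p.primeCompl, x j = LocalizedModule.mk m s := by
    intro j
    induction hj : x j using LocalizedModule.induction_on with
    | h m s => obtain ⟨i, hi⟩ := htop m; exact ⟨i, m, hi, s, rfl⟩
  choose i m hm s hs using hx
  let k := Finset.univ.sup i
  refine ⟨LocalizedModule p.primeCompl (Y k), inferInstance, inferInstance,
    IsLocalizedModule.map p.primeCompl (LocalizedModule.mkLinearMap _ (Y k))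
      (LocalizedModule.mkLinearMap _ M) (Y k).subtype, hY k p ha,
    IsLocalizedModule.map_injective p.primeCompl _ _ _ (Submodule.injective_subtype _), ?_⟩
  intro j
  refine ⟨LocalizedModule.mk ⟨m j, hmono (Finset.le_sup (Finset.mem_univ j)) (hm j)⟩ (s j), ?_⟩
  rw [hs, IsLocalizedModule.map_LocalizedModules]
  rfl

theorem GF.of_finite [IsDomain A] [IsNoetherianRing A] [Module.Finite A M] :
    ∃ a : A, a ≠ 0 ∧ GF a M := by
  have hfp : Module.FinitePresentation A M := Module.finitePresentation_of_finite A M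
  have ho : IsOpen (Module.freeLocus A M) := Module.isOpen_freeLocus
  have hb : (⊥ : PrimeSpectrum A) ∈ Module.freeLocus A M := by
    have hF : IsField (Localization.AtPrime (⊥ : PrimeSpectrum A).asIdeal) := by
      have : IsFractionRing A (Localization.AtPrime (⊥ : PrimeSpectrum A).asIdeal) := by
        have h : (⊥ : PrimeSpectrum A).asIdeal.primeCompl = nonZeroDivisors A := by
          ext x; simp [Ideal.primeCompl]
        unfold IsFractionRing
        rw [← h]; infer_instance
      exact @Field.toIsField _ (IsFractionRing.toField A)
    let _ := hF.toField
    exact Module.Free.of_divisionRing _ _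
  obtain ⟨_, ⟨r, rfl⟩, h1, h2⟩ :=
    PrimeSpectrum.isTopologicalBasis_basic_opens.exists_subset_of_mem_open hb ho
  refine ⟨r, fun h => h1 (by simp [h]), fun p hp hr => ?_⟩
  have h3 : Module.Free (Localization.AtPrime p) (LocalizedModule p.primeCompl M) :=
    h2 (show (⟨p, hp⟩ : PrimeSpectrum A) ∈ _ from hr)
  exact Module.Flat.trans A (Localization.AtPrime p) _
end

/-- Generic flatness for all finite `B`-modules. -/
def GFR (A B : Type u) [CommRing A] [CommRing B] [Algebra A B] : Prop :=
  ∀ (M : Type u) [AddCommGroup M] [Module A M] [Module B M] [IsScalarTower A B M]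
    [Module.Finite B M], ∃ a : A, a ≠ 0 ∧ GF a M

theorem GFR.base (A : Type u) [CommRing A] [IsDomain A] [IsNoetherianRing A] : GFR A A := by
  intro M _ m1 m2 _ hfin
  have : m1 = m2 := by
    apply Module.ext
    ext a x
    have h := @IsScalarTower.smul_assoc A A M _ m2.toSMul m1.toSMul _ a 1 x
    rw [smul_eq_mul, mul_one] at h
    exact (h.trans (congrArg (m1.smul a) (@one_smul A M _ m2.toMulAction x))).symm
  subst this
  exact GF.of_finite

theorem GFR.of_surj {A B B' : Type u} [CommRing A] [CommRing B] [CommRing B'] [Algebra A B]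
    [Algebra A B'] (f : B →ₐ[A] B') (hf : Function.Surjective f) (h : GFR A B) : GFR A B' := by
  intro M _ _ _ _ hfin
  let _ : Module B M := Module.compHom M f.toRingHom
  have hs : ∀ (b : B) (m : M), b • m = f b • m := fun _ _ => rfl
  have : IsScalarTower A B M := ⟨fun a b m => by rw [hs, hs, map_smul, smul_assoc]⟩
  have : Module.Finite B M := by
    obtain ⟨s, hs'⟩ := hfin.fg_top
    refine ⟨⟨s, ?_⟩⟩
    rw [eq_top_iff]
    intro m _
    have hm : m ∈ Submodule.span B' (s : Set M) := by rw [hs']; trivial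
    induction hm using Submodule.span_induction with
    | mem x hx => exact Submodule.subset_span hx
    | zero => exact zero_mem _
    | add x y _ _ hx hy => exact add_mem (hx trivial) (hy trivial)
    | smul b x _ hx =>
      obtain ⟨c, rfl⟩ := hf b
      rw [← hs]
      exact Submodule.smul_mem _ _ (hx trivial)
  exact h M

section step
variable {A B M : Type u} [CommRing A] [CommRing B] [Algebra A B] [AddCommGroup M]
  [Module A M] [Module B M] [IsScalarTower A B M]

theorem GF.ext_sub {a : A} {N N' : Submodule B M} (hN : N ≤ N') (h : GF a N)
    (h' : GF a (N' ⧸ N.submoduleOf N')) : GF a N' := by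
  refine GF.ext ((Submodule.inclusion hN).restrictScalars A)
    ((N.submoduleOf N').mkQ.restrictScalars A)
    (Submodule.inclusion_injective hN) (fun q => ?_) ?_ h h'
  · obtain ⟨x, hx⟩ := Submodule.Quotient.mk_surjective (N.submoduleOf N') q
    exact ⟨x, hx⟩
  intro x
  rw [LinearMap.restrictScalars_apply, Submodule.mkQ_apply, Submodule.Quotient.mk_eq_zero]
  constructor
  · intro hx; exact ⟨⟨x.1, hx⟩, rfl⟩
  · rintro ⟨y, rfl⟩; exact y.2

/-- The filtration by degree. -/
def gfFil (φ : M →ₗ[B] M) (N0 : Submodule B M) : ℕ → Submodule B M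
  | 0 => N0
  | i + 1 => gfFil φ N0 i ⊔ N0.map (φ ^ (i + 1))

theorem gfFil_mono (φ : M →ₗ[B] M) (N0 : Submodule B M) : Monotone (gfFil φ N0) :=
  monotone_nat_of_le_succ fun _ => le_sup_left

theorem gfFil_map (φ : M →ₗ[B] M) (N0 : Submodule B M) (i : ℕ) {m : M} (hm : m ∈ gfFil φ N0 i) :
    φ m ∈ gfFil φ N0 (i + 1) := by
  induction i generalizing m with
  | zero => exact Submodule.mem_sup_right ⟨m, hm, by simp⟩
  | succ i ih =>
    obtain ⟨x, hx, y, ⟨z, hz, rfl⟩, rfl⟩ := Submodule.mem_sup.1 hm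
    rw [map_add]
    refine add_mem (gfFil_mono φ N0 (Nat.le_succ (i+1)) (ih hx)) (Submodule.mem_sup_right ⟨z, hz, ?_⟩)
    rw [pow_succ' φ (i + 1)]; rfl

theorem gfFil_pow (φ : M →ₗ[B] M) (N0 : Submodule B M) (i : ℕ) (m : N0) :
    (φ ^ i) m.1 ∈ gfFil φ N0 i := by
  cases i with
  | zero => exact m.2
  | succ i => exact Submodule.mem_sup_right ⟨m, m.2, rfl⟩

/-- The map onto graded pieces. -/
def gfPsi (φ : M →ₗ[B] M) (N0 : Submodule B M) (i : ℕ) :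
    N0 →ₗ[B] (gfFil φ N0 (i + 1) ⧸ (gfFil φ N0 i).submoduleOf (gfFil φ N0 (i + 1))) :=
  Submodule.mkQ _ ∘ₗ ((φ ^ (i + 1)).domRestrict N0).codRestrict _ (gfFil_pow φ N0 (i + 1))

theorem mem_ker_gfPsi (φ : M →ₗ[B] M) (N0 : Submodule B M) (i : ℕ) (m : N0) :
    m ∈ LinearMap.ker (gfPsi φ N0 i) ↔ (φ ^ (i + 1)) m.1 ∈ gfFil φ N0 i := by
  rw [LinearMap.mem_ker, gfPsi, LinearMap.comp_apply, Submodule.mkQ_apply,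
    Submodule.Quotient.mk_eq_zero]
  rfl

theorem gfPsi_surj (φ : M →ₗ[B] M) (N0 : Submodule B M) (i : ℕ) :
    Function.Surjective (gfPsi φ N0 i) := by
  intro q
  obtain ⟨⟨n, hn⟩, rfl⟩ := Submodule.mkQ_surjective _ q
  obtain ⟨x, hx, y, ⟨z, hz, rfl⟩, rfl⟩ := Submodule.mem_sup.1 hn
  refine ⟨⟨z, hz⟩, ?_⟩
  simp only [gfPsi, LinearMap.comp_apply]
  rw [← sub_eq_zero, ← map_sub, Submodule.mkQ_apply, Submodule.Quotient.mk_eq_zero]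
  change (φ ^ (i + 1)) z - (x + (φ ^ (i + 1)) z) ∈ gfFil φ N0 i
  simpa using hx

theorem gf_step [IsDomain A] [IsNoetherianRing B] (hB : GFR A B) (φ : M →ₗ[B] M)
    (N0 : Submodule B M) (hN0 : N0.FG) (htop : ∀ m, ∃ i, m ∈ gfFil φ N0 i) :
    ∃ a : A, a ≠ 0 ∧ GF a M := by
  have : Module.Finite B N0 := Module.Finite.iff_fg.2 hN0
  let K : ℕ →o Submodule B N0 := ⟨fun i => LinearMap.ker (gfPsi φ N0 i), by
    apply monotone_nat_of_le_succ
    intro i m hm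
    rw [mem_ker_gfPsi] at hm ⊢
    have := gfFil_map φ N0 i hm
    rwa [pow_succ' φ (i + 1)]⟩
  obtain ⟨n, hn⟩ := monotone_stabilizes_iff_noetherian.2 (inferInstance : IsNoetherian B N0) K
  obtain ⟨a0, ha0, h0⟩ := hB N0
  have hK : ∀ i, ∃ a : A, a ≠ 0 ∧ GF a (N0 ⧸ K i) := fun i => hB _
  choose a ha h using hK
  let b := a0 * ∏ i ∈ Finset.range (n + 1), a i
  have hb : b ≠ 0 := mul_ne_zero ha0 (Finset.prod_ne_zero_iff.2 fun i _ => ha i)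
  have hbK' : ∀ i ≤ n, GF b (N0 ⧸ K i) := fun i hi => (h i).mono
    ((Finset.dvd_prod_of_mem a (Finset.mem_range.2 (by omega))).mul_left a0)
  have hbK : ∀ i, GF b (N0 ⧸ K i) := by
    intro i
    by_cases hi : i ≤ n
    · exact hbK' i hi
    · rw [← hn i (by omega)]; exact hbK' n le_rfl
  have hF : ∀ i, GF b (gfFil φ N0 i) := by
    intro i
    induction i with
    | zero => exact h0.mono (Dvd.intro _ rfl)
    | succ i ih =>
      exact GF.ext_sub (gfFil_mono φ N0 (Nat.le_succ i)) ih ((hbK i).equiv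
          (((gfPsi φ N0 i).quotKerEquivOfSurjective (gfPsi_surj φ N0 i)).restrictScalars A))
  exact ⟨b, hb, GF.union (fun i => (gfFil φ N0 i).restrictScalars A)
    (fun i j hij => gfFil_mono φ N0 hij) htop hF⟩

end step

open Polynomial in
theorem GFR.poly {A B : Type u} [CommRing A] [IsDomain A] [CommRing B] [Algebra A B]
    [IsNoetherianRing B] (hB : GFR A B) : GFR A B[X] := by
  intro M _ _ _ _ hfin
  let _ : Module B M := Module.compHom M (C : B →+* B[X])
  have hs : ∀ (b : B) (m : M), b • m = (C b : B[X]) • m := fun _ _ => rfl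
  have : IsScalarTower A B M := ⟨fun a b m => by
    rw [hs, hs, ← smul_assoc, ← Polynomial.smul_C]⟩
  have : IsScalarTower B B[X] M := ⟨fun a b m => by
    rw [hs, ← smul_assoc, smul_eq_mul, Polynomial.smul_eq_C_mul]⟩
  obtain ⟨s, hs'⟩ := hfin.fg_top
  let φ : M →ₗ[B] M :=
    { toFun := fun m => (X : B[X]) • m
      map_add' := fun _ _ => smul_add _ _ _
      map_smul' := fun b m => by
        simp only [hs, RingHom.id_apply, ← mul_smul, mul_comm] }
  refine gf_step hB φ (Submodule.span B (s : Set M)) ⟨s, rfl⟩ ?_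
  intro m
  have hm : m ∈ Submodule.span B[X] (s : Set M) := by rw [hs']; trivial
  have hadd : ∀ x y, (∃ i, x ∈ gfFil φ (Submodule.span B (s : Set M)) i) →
      (∃ i, y ∈ gfFil φ (Submodule.span B (s : Set M)) i) →
      (∃ i, x + y ∈ gfFil φ (Submodule.span B (s : Set M)) i) := by
    rintro x y ⟨i, hi⟩ ⟨j, hj⟩
    exact ⟨max i j, add_mem (gfFil_mono _ _ (le_max_left i j) hi)
      (gfFil_mono _ _ (le_max_right i j) hj)⟩
  induction hm using Submodule.span_induction with
  | mem x hx => exact ⟨0, Submodule.subset_span hx⟩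
  | zero => exact ⟨0, zero_mem _⟩
  | add x y _ _ hx hy => exact hadd x y hx hy
  | smul b x _ hx =>
    induction b using Polynomial.induction_on with
    | C a => obtain ⟨i, hi⟩ := hx; exact ⟨i, by rw [← hs]; exact Submodule.smul_mem _ _ hi⟩
    | add p q hp hq => rw [add_smul]; exact hadd _ _ hp hq
    | monomial n a h =>
      obtain ⟨i, hi⟩ := h
      refine ⟨i + 1, ?_⟩
      have : (C a * X ^ (n + 1) : B[X]) • x = φ ((C a * X ^ n : B[X]) • x) := by
        simp only [φ, LinearMap.coe_mk, AddHom.coe_mk, ← mul_smul]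
        congr 1; ring
      rw [this]
      exact gfFil_map _ _ _ hi

theorem GFR.mvPoly (A : Type u) [CommRing A] [IsDomain A] [IsNoetherianRing A] (n : ℕ) :
    GFR A (MvPolynomial (Fin n) A) := by
  induction n with
  | zero =>
    exact GFR.of_surj (MvPolynomial.isEmptyAlgEquiv A (Fin 0)).symm.toAlgHom
      (MvPolynomial.isEmptyAlgEquiv A (Fin 0)).symm.surjective (GFR.base A)
  | succ n ih =>
    exact GFR.of_surj (MvPolynomial.finSuccEquiv A n).symm.toAlgHom
      (MvPolynomial.finSuccEquiv A n).symm.surjective ih.poly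

theorem GFR.of_finiteType (A B : Type u) [CommRing A] [IsDomain A] [IsNoetherianRing A] [CommRing B]
    [Algebra A B] [Algebra.FiniteType A B] : GFR A B := by
  obtain ⟨n, f, hf⟩ := Algebra.FiniteType.iff_quotient_mvPolynomial''.1
    (inferInstance : Algebra.FiniteType A B)
  exact GFR.of_surj f hf (GFR.mvPoly A n)

open TensorProduct in
theorem gf_rTensor_injective {A B C : Type u} [CommRing A] [AddCommGroup B] [AddCommGroup C]
    [Module A B] [Module A C] (p : Ideal A) [p.IsPrime] (μ : B →ₗ[A] B) (g : B →ₗ[A] C)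
    (hμ : Function.Injective μ) (hg : Function.Surjective g) (hex : Function.Exact μ g)
    [Module.Flat A (LocalizedModule p.primeCompl C)] :
    Function.Injective (μ.rTensor p.ResidueField) := by
  let ι := LocalizedModule.mkLinearMap p.primeCompl B
  let μp := IsLocalizedModule.map p.primeCompl ι ι μ
  have h1 : Function.Injective (μp.lTensor p.ResidueField) :=
    LinearMap.lTensor_injective_of_exact_of_flat _
      (IsLocalizedModule.map_surjective p.primeCompl ι
        (LocalizedModule.mkLinearMap p.primeCompl C) g hg) μp
      (IsLocalizedModule.map_injective p.primeCompl ι ι μ hμ)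
      (LocalizedModule.map_exact p.primeCompl μ g hex) p.ResidueField
  have h2 : Function.Injective (μp.rTensor p.ResidueField) :=
    (LinearMap.lTensor_inj_iff_rTensor_inj _ _).1 h1
  have h3 : Function.Injective (ι.rTensor p.ResidueField) := by
    have hl : IsLocalizedModule p.primeCompl (ι.rTensor p.ResidueField) :=
      IsLocalizedModule.rTensor A p.primeCompl (N := p.ResidueField) ι
    intro x y hxy
    obtain ⟨c, hc⟩ := IsLocalizedModule.exists_of_eq (S := p.primeCompl) hxy
    have hc0 : algebraMap A p.ResidueField c ≠ 0 := by
      rw [Ne, Ideal.algebraMap_residueField_eq_zero]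
      exact c.2
    have key : ∀ z : B ⊗[A] p.ResidueField,
        (LinearMap.lTensor B (LinearMap.mulLeft A (algebraMap A p.ResidueField c)⁻¹)) (c • z) = z := by
      intro z
      induction z with
      | zero => simp
      | add x y hx hy => rw [smul_add, map_add, hx, hy]
      | tmul b k =>
        rw [Submonoid.smul_def, ← TensorProduct.tmul_smul, LinearMap.lTensor_tmul,
          LinearMap.mulLeft_apply, Algebra.smul_def, inv_mul_cancel_left₀ hc0]
    rw [← key x, hc, key]
  have hcomm : μp ∘ₗ ι = ι ∘ₗ μ := by
    ext x
    exact IsLocalizedModule.map_apply p.primeCompl ι ι μ x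
  have h4 : Function.Injective ((ι.rTensor p.ResidueField) ∘ₗ (μ.rTensor p.ResidueField)) := by
    rw [← LinearMap.rTensor_comp, ← hcomm, LinearMap.rTensor_comp]
    exact h2.comp h3
  exact Function.Injective.of_comp (f := ι.rTensor p.ResidueField) h4

open TensorProduct in
theorem gf_dom {A B : Type u} [CommRing A] [IsDomain A] [IsNoetherianRing A] [CommRing B]
    [Algebra A B] [Algebra.FiniteType A B] (h : B) (hh : h ∈ nonZeroDivisors B) :
    ∃ a : A, a ≠ 0 ∧ ∀ p : PrimeSpectrum A, a ∉ p.asIdeal → ∀ g : B,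
      p ∈ PrimeSpectrum.comap (algebraMap A B) '' PrimeSpectrum.basicOpen g →
      p ∈ PrimeSpectrum.comap (algebraMap A B) '' PrimeSpectrum.basicOpen (g * h) := by
  obtain ⟨a, ha, hGF⟩ := GFR.of_finiteType A B (B ⧸ Ideal.span {h})
  refine ⟨a, ha, fun p hp g hg => ?_⟩
  have := hGF p.asIdeal hp
  let μ : B →ₗ[A] B := LinearMap.mulLeft A h
  have hμ : Function.Injective μ := by
    intro x y hxy
    exact (mul_cancel_left_mem_nonZeroDivisors hh).1 hxy
  have inj := gf_rTensor_injective p.asIdeal μ (Ideal.Quotient.mkₐ A (Ideal.span {h})).toLinearMap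
    hμ (Ideal.Quotient.mk_surjective) (by
      intro x
      change Ideal.Quotient.mk _ x = 0 ↔ _
      rw [Ideal.Quotient.eq_zero_iff_mem, Ideal.mem_span_singleton]
      constructor
      · rintro ⟨y, rfl⟩; exact ⟨y, rfl⟩
      · rintro ⟨y, rfl⟩; exact ⟨y, rfl⟩)
  have hmul : ∀ z : B ⊗[A] p.asIdeal.ResidueField,
      μ.rTensor p.asIdeal.ResidueField z = algebraMap B (B ⊗[A] p.asIdeal.ResidueField) h * z := by
    intro z
    induction z with
    | zero => simp
    | add x y hx hy => rw [map_add, hx, hy, mul_add]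
    | tmul b k => simp [μ, Algebra.TensorProduct.algebraMap_apply]
  rw [PrimeSpectrum.mem_image_comap_basicOpen] at hg ⊢
  rintro ⟨n, hn⟩
  apply hg
  refine ⟨n, ?_⟩
  rw [map_mul, mul_pow, mul_comm] at hn
  have hk : ∀ (n : ℕ) (z : B ⊗[A] p.asIdeal.ResidueField),
      algebraMap B (B ⊗[A] p.asIdeal.ResidueField) h ^ n * z = 0 → z = 0 := by
    intro n
    induction n with
    | zero => intro z hz; simpa using hz
    | succ n ih =>
      intro z hz
      rw [pow_succ, mul_assoc] at hz
      have := ih _ hz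
      rw [← hmul] at this
      exact inj (this.trans (map_zero _).symm)
  exact hk n _ hn

theorem gf_exists_nzd {R : Type u} [CommRing R] [IsReduced R] [IsNoetherianRing R]
    (O : Set (PrimeSpectrum R)) (hO : IsOpen O) (hd : Dense O) :
    ∃ h ∈ nonZeroDivisors R, (PrimeSpectrum.basicOpen h : Set (PrimeSpectrum R)) ⊆ O := by
  obtain ⟨s, hs⟩ := (PrimeSpectrum.isOpen_iff O).1 hO
  rw [← PrimeSpectrum.zeroLocus_span] at hs
  set I := Ideal.span s
  have hfin := minimalPrimes.finite_of_isNoetherianRing R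
  -- finite product trick for minimality
  have hI : ¬ ((I : Set R) ⊆ ⋃ i ∈ (hfin.toFinset : Set (Ideal R)), (i : Set R)) := by
    intro hsub
    rw [Ideal.subset_union_prime (f := fun i : Ideal R => i) ⊥ ⊥
      (fun i hi _ _ => (hfin.mem_toFinset.1 hi).1.1)] at hsub
    obtain ⟨P, hP, hIP⟩ := hsub
    rw [hfin.mem_toFinset] at hP
    have hPp : P.IsPrime := hP.1.1
    -- irreducible component: find an open neighbourhood of `P` inside `V(P)`
    have : ¬ ((⨅ Q ∈ hfin.toFinset.erase P, Q) ≤ P) := by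
      intro hle
      obtain ⟨Q, hQ, hQP⟩ := (Ideal.IsPrime.inf_le' hPp).1 (by
        rw [Finset.inf_eq_iInf]; exact hle)
      rw [Finset.mem_erase, hfin.mem_toFinset] at hQ
      exact hQ.1 (le_antisymm hQP (hP.2 ⟨hQ.2.1.1, bot_le⟩ hQP))
    obtain ⟨x, hx, hxP⟩ := SetLike.not_le_iff_exists.1 this
    obtain ⟨q, hq, hqO⟩ := hd.inter_open_nonempty _ (PrimeSpectrum.basicOpen x).2 ⟨⟨P, hPp⟩, hxP⟩
    obtain ⟨Q, hQ, hQq⟩ := Ideal.exists_minimalPrimes_le (bot_le (a := q.asIdeal))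
    have hQP : Q = P := by
      by_contra hne
      apply hq
      apply hQq
      have := (Submodule.mem_iInf _).1 hx Q
      exact (Submodule.mem_iInf _).1 this (Finset.mem_erase.2 ⟨hne, hfin.mem_toFinset.2 hQ⟩)
    have : q ∈ Oᶜ := by
      rw [hs, PrimeSpectrum.mem_zeroLocus]
      exact hIP.trans (hQP ▸ hQq)
    exact this hqO
  obtain ⟨h, hhI, hh⟩ := Set.not_subset.1 hI
  refine ⟨h, ?_, ?_⟩
  · rw [mem_nonZeroDivisors_iff_right]
    intro x hx
    have : x ∈ nilradical R := by
      rw [nilradical, Ideal.radical_eq_sInf, Ideal.mem_sInf]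
      rintro q ⟨-, hq⟩
      obtain ⟨Q, hQ, hQq⟩ := Ideal.exists_minimalPrimes_le (bot_le (a := q))
      apply hQq
      have h0 : x * h ∈ Q := by rw [hx]; exact zero_mem _
      refine (hQ.1.1.mem_or_mem h0).resolve_right fun hQh => hh ?_
      exact Set.mem_biUnion (Finset.mem_coe.2 (hfin.mem_toFinset.2 hQ)) hQh
    rwa [nilradical_eq_zero, Ideal.zero_eq_bot, Ideal.mem_bot] at this
  · intro q hq
    by_contra hqO
    have : q ∈ Oᶜ := hqO
    rw [hs, PrimeSpectrum.mem_zeroLocus] at this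
    exact hq (this hhI)

theorem gf_homeo (R : Type u) [CommRing R] :
    IsHomeomorph (PrimeSpectrum.comap (Ideal.Quotient.mk (nilradical R))) := by
  have h1 := PrimeSpectrum.isClosedEmbedding_comap_of_surjective _
    (Ideal.Quotient.mk (nilradical R)) Ideal.Quotient.mk_surjective
  rw [isHomeomorph_iff_isEmbedding_surjective]
  refine ⟨h1.isEmbedding, ?_⟩
  rw [← Set.range_eq_univ, range_comap_of_surjective _ _ Ideal.Quotient.mk_surjective,
    Ideal.mk_ker, PrimeSpectrum.zeroLocus_nilradical]

theorem gf_affine {A B : Type u} [CommRing A] [IsNoetherianRing A] [CommRing B]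
    [IrreducibleSpace (PrimeSpectrum A)] (φ : A →+* B) (hφ : φ.FiniteType)
    (O : Set (PrimeSpectrum B)) (hO : IsOpen O) (hd : Dense O) :
    ∃ W : Set (PrimeSpectrum A), IsOpen W ∧ W.Nonempty ∧ ∀ q : PrimeSpectrum B,
      PrimeSpectrum.comap φ q ∈ W → ∀ U : Set (PrimeSpectrum B), IsOpen U → q ∈ U →
      ∃ q' ∈ U, q' ∈ O ∧ PrimeSpectrum.comap φ q' = PrimeSpectrum.comap φ q := by
  have hprime : (nilradical A).IsPrime := PrimeSpectrum.irreducibleSpace_iff_isPrime_nilradical.1 inferInstance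
  have : IsNoetherianRing B := by
    algebraize [φ]
    exact Algebra.FiniteType.isNoetherianRing A B
  let φ' : A ⧸ nilradical A →+* B ⧸ nilradical B := Ideal.quotientMap (nilradical B) φ
    (fun x hx => (mem_nilradical.1 hx).map φ)
  have hφ'c : φ'.comp (Ideal.Quotient.mk _) = (Ideal.Quotient.mk _).comp φ := by
    ext x; rfl
  have hφ' : φ'.FiniteType := by
    apply RingHom.FiniteType.of_comp_finiteType (f := Ideal.Quotient.mk (nilradical A))
    rw [hφ'c]
    exact hφ.comp_surjective Ideal.Quotient.mk_surjective
  have hred : IsReduced (B ⧸ nilradical B) :=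
    (Ideal.isRadical_iff_quotient_reduced _).1 (Ideal.radical_isRadical _)
  have hcomm : ∀ q, PrimeSpectrum.comap φ (PrimeSpectrum.comap (Ideal.Quotient.mk _) q) =
      PrimeSpectrum.comap (Ideal.Quotient.mk _) (PrimeSpectrum.comap φ' q) := by
    intro q
    rw [← PrimeSpectrum.comap_comp_apply, ← PrimeSpectrum.comap_comp_apply, hφ'c]
  have hB := gf_homeo B
  obtain ⟨h, hh, hhO⟩ := gf_exists_nzd _ (hO.preimage hB.continuous)
    (hd.preimage hB.isOpenMap)
  let _ : Algebra (A ⧸ nilradical A) (B ⧸ nilradical B) := φ'.toAlgebra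
  have : Algebra.FiniteType (A ⧸ nilradical A) (B ⧸ nilradical B) := hφ'
  obtain ⟨a', ha', H⟩ := gf_dom (A := A ⧸ nilradical A) h hh
  obtain ⟨a, rfl⟩ := Ideal.Quotient.mk_surjective a'
  refine ⟨PrimeSpectrum.basicOpen a, (PrimeSpectrum.basicOpen a).2, ⟨⟨nilradical A, hprime⟩, ?_⟩, ?_⟩
  · intro hmem
    exact ha' (Ideal.Quotient.eq_zero_iff_mem.2 hmem)
  intro q hqW U hU hqU
  obtain ⟨_, ⟨g, rfl⟩, hqg, hgU⟩ :=
    PrimeSpectrum.isTopologicalBasis_basic_opens.exists_subset_of_mem_open hqU hU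
  obtain ⟨q, rfl⟩ := hB.surjective q
  obtain ⟨r, hr, hrq⟩ := H (PrimeSpectrum.comap φ' q) (by rw [hcomm] at hqW; exact hqW)
    (Ideal.Quotient.mk _ g) ⟨q, hqg, rfl⟩
  rw [SetLike.mem_coe, PrimeSpectrum.basicOpen_mul] at hr
  refine ⟨PrimeSpectrum.comap (Ideal.Quotient.mk _) r, hgU hr.1, hhO hr.2, ?_⟩
  rw [hcomm, hcomm]
  exact congrArg _ hrq

open AlgebraicGeometry CategoryTheory

theorem gf_piece {P N : Scheme.{u}} [IsLocallyNoetherian N] (f : P ⟶ N)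
    [LocallyOfFiniteType f] [IrreducibleSpace N]
    (O : Set P) (hO : IsOpen O) (hd : Dense O) (V : N.Opens) (hV : IsAffineOpen V)
    (hVne : (V : Set N).Nonempty) (U : P.Opens) (hU : IsAffineOpen U) (e : U ≤ f ⁻¹ᵁ V) :
    ∃ W : Set N, IsOpen W ∧ W.Nonempty ∧ ∀ z ∈ U, f z ∈ W →
      ∀ T : Set P, IsOpen T → z ∈ T → ∃ z' ∈ T, z' ∈ O ∧ f z' = f z := by
  have hnoeth : IsNoetherianRing Γ(N, V) := IsLocallyNoetherian.component_noetherian ⟨V, hV⟩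
  have hirr : IrreducibleSpace (Spec Γ(N, V)) := by
    obtain ⟨y, hy⟩ := hVne
    rw [← hV.range_fromSpec] at hy
    obtain ⟨y', -⟩ := hy
    have : Nonempty (Spec Γ(N, V)) := ⟨y'⟩
    exact hV.fromSpec.isOpenEmbedding.irreducibleSpace
  have hirr' : IrreducibleSpace (PrimeSpectrum Γ(N, V)) := hirr
  have hft : (f.appLE V U e).hom.FiniteType :=
    LocallyOfFiniteType.finiteType_appLE f hV hU e
  have hsq : ∀ q : Spec Γ(P, U),
      f (hU.fromSpec q) = hV.fromSpec (PrimeSpectrum.comap (f.appLE V U e).hom q) := by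
    intro q
    have := congrArg (fun g => g q) (IsAffineOpen.SpecMap_appLE_fromSpec f hV hU e)
    exact this.symm
  have hc : Continuous hU.fromSpec := hU.fromSpec.continuous
  obtain ⟨W, hWo, hWne, hW⟩ := gf_affine (f.appLE V U e).hom hft (hU.fromSpec ⁻¹' O)
    (hO.preimage hc) (hd.preimage hU.fromSpec.isOpenEmbedding.isOpenMap)
  refine ⟨hV.fromSpec '' W, hV.fromSpec.isOpenEmbedding.isOpenMap _ hWo, hWne.image _, ?_⟩
  intro z hzU hzW T hT hzT
  have hz : z ∈ Set.range hU.fromSpec := by rw [hU.range_fromSpec]; exact hzU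
  obtain ⟨q, rfl⟩ := hz
  rw [hsq] at hzW
  obtain ⟨w, hw, hwq⟩ := hzW
  have hwq' := hV.fromSpec.isOpenEmbedding.injective hwq
  obtain ⟨q', hq'T, hq'O, hq'⟩ := hW q (hwq' ▸ hw) (hU.fromSpec ⁻¹' T) (hT.preimage hc) hzT
  exact ⟨hU.fromSpec q', hq'T, hq'O, (hsq q').trans ((congrArg (fun r => hV.fromSpec r) hq').trans (hsq q).symm)⟩

/-- Let `f : P ⟶ N` be a dominant morphism of schemes of finite type over `ℂ`, with `N`
irreducible, and let `O` be a dense open subset of `P`.  Then there is a nonempty open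
`W ⊆ N` such that for every closed point `y ∈ W`, the set `O ∩ f⁻¹(y)` is dense in the
fiber `f⁻¹(y)` (for the subspace topology). -/
theorem stmt_1 (P N : Scheme)
    (pP : P ⟶ Spec (CommRingCat.of ℂ)) (pN : N ⟶ Spec (CommRingCat.of ℂ))
    [LocallyOfFiniteType pP] [QuasiCompact pP]
    [LocallyOfFiniteType pN] [QuasiCompact pN]
    (f : P ⟶ N) (hf : f ≫ pN = pP)
    (hdom : DenseRange f.base)
    [IrreducibleSpace N]
    (O : Set P) (hOopen : IsOpen O) (hOdense : Dense O) :
    ∃ W : Set N, IsOpen W ∧ W.Nonempty ∧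
      ∀ y ∈ W, IsClosed ({y} : Set N) →
        Dense {z : (f.base ⁻¹' {y} : Set P) | (z : P) ∈ O} := by
  have : LocallyOfFiniteType (f ≫ pN) := by rw [hf]; infer_instance
  have hfft : LocallyOfFiniteType f := locallyOfFiniteType_of_comp f pN
  have hNln : IsLocallyNoetherian N := LocallyOfFiniteType.isLocallyNoetherian pN
  have hPln : IsLocallyNoetherian P := LocallyOfFiniteType.isLocallyNoetherian pP
  have hPc : CompactSpace P := QuasiCompact.compactSpace_of_compactSpace pP
  have hPn : AlgebraicGeometry.IsNoetherian P := { }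
  have hPs : TopologicalSpace.NoetherianSpace P := inferInstance
  obtain ⟨y0⟩ := (inferInstance : Nonempty N)
  obtain ⟨V, hV, hyV, -⟩ := exists_isAffineOpen_mem_and_subset (U := (⊤ : N.Opens)) (x := y0) trivial
  have hcov : ∀ x : P, ∃ U : P.Opens, f x ∈ V → IsAffineOpen U ∧ x ∈ U ∧ U ≤ f ⁻¹ᵁ V := by
    intro x
    by_cases hx : f x ∈ V
    · obtain ⟨U, h1, h2, h3⟩ := exists_isAffineOpen_mem_and_subset (U := f ⁻¹ᵁ V) (x := x) hx
      exact ⟨U, fun _ => ⟨h1, h2, h3⟩⟩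
    · exact ⟨⊤, fun h => (hx h).elim⟩
  choose U hU using hcov
  obtain ⟨t, ht, htc⟩ := (TopologicalSpace.NoetherianSpace.isCompact
    ((f ⁻¹ᵁ V : P.Opens) : Set P)).elim_nhds_subcover (fun x => (U x : Set P))
    (fun x hx => (U x).2.mem_nhds (hU x hx).2.1)
  have hW : ∀ x : P, ∃ W : Set N, IsOpen W ∧ W.Nonempty ∧ (x ∈ t → ∀ z ∈ U x, f z ∈ W →
      ∀ T : Set P, IsOpen T → z ∈ T → ∃ z' ∈ T, z' ∈ O ∧ f z' = f z) := by
    intro x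
    by_cases hx : x ∈ t
    · obtain ⟨h1, h2, h3⟩ := hU x (ht x hx)
      obtain ⟨W, ho, hn, h⟩ := gf_piece f O hOopen hOdense V hV ⟨y0, hyV⟩ (U x) h1 h3
      exact ⟨W, ho, hn, fun _ => h⟩
    · exact ⟨Set.univ, isOpen_univ, ⟨y0, trivial⟩, fun h => (hx h).elim⟩
  choose W hWo hWn hW using hW
  have key : ∀ s : Finset P, IsOpen ((V : Set N) ∩ ⋂ x ∈ s, W x) ∧
      ((V : Set N) ∩ ⋂ x ∈ s, W x).Nonempty := by
    intro s
    classical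
    induction s using Finset.induction_on with
    | empty => simpa using ⟨V.2, ⟨y0, hyV⟩⟩
    | insert a s _ ih =>
      have heq : (V : Set N) ∩ ⋂ x ∈ insert a s, W x = W a ∩ ((V : Set N) ∩ ⋂ x ∈ s, W x) := by
        rw [Finset.set_biInter_insert, Set.inter_left_comm]
      rw [heq]
      exact ⟨(hWo a).inter ih.1, nonempty_preirreducible_inter (hWo a) ih.1 (hWn a) ih.2⟩
  refine ⟨_, (key t).1, (key t).2, ?_⟩
  rintro y ⟨hyV', hyW⟩ -
  rw [dense_iff_inter_open]
  rintro T' ⟨T, hT, rfl⟩ ⟨⟨z, hz⟩, hzT⟩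
  have hzy : f z = y := hz
  obtain ⟨x, hxt, hzx⟩ := Set.mem_iUnion₂.1 (htc (show z ∈ ((f ⁻¹ᵁ V : P.Opens) : Set P) from
    (show f z ∈ V by rw [hzy]; exact hyV')))
  obtain ⟨z', h1, h2, h3⟩ := hW x hxt z hzx
    (by rw [hzy]; exact Set.mem_iInter₂.1 hyW x hxt) T hT hzT
  exact ⟨⟨z', h3.trans hzy⟩, h1, h2⟩
end
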